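/- Let c : ℝⁿ → ℝ and h : ℝⁿ → ℝᵐ be twice continuously differentiable and let μ > 0. Define v(x,λ) = ∇c(x) + (Dh(x))*λ + μ (Dh(x))*(h(x)). Suppose x : ℝ → ℝⁿ and λ : ℝ → ℝᵐ are differentiable curves satisfying x′(t) = −v(x(t), λ(t)) and λ′(t) = μ h(x(t)), and suppose that for every t the Fréchet derivative A(t) of y ↦ v(y, λ(t)) at x(t) is positive semidefinite, i.e., ⟨w, A(t) w⟩ ≥ 0 for all w ∈ ℝⁿ. Then the energy E(t) = (1/2)‖v(x(t),λ(t))‖² + (μ/2)‖h(x(t))‖² is nonincreasing in t. -/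

import Mathlib

open RealInnerProductSpace

theorem ContinuousLinearMap.differentiable_adjoint {E F : Type*} [NormedAddCommGroup E]
    [InnerProductSpace ℝ E] [CompleteSpace E] [NormedAddCommGroup F] [InnerProductSpace ℝ F]
    [CompleteSpace F] :
    Differentiable ℝ (fun T : E →L[ℝ] F => T.adjoint) :=
  (AddMonoidHom.toRealLinearMap
    (ContinuousLinearMap.adjoint (𝕜 := ℝ) (E := E) (F := F) : (E →L[ℝ] F) →+ (F →L[ℝ] E))
    (ContinuousLinearMap.adjoint (𝕜 := ℝ) (E := E) (F := F)).continuous).differentiable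

theorem ContDiff.differentiable_gradient {E : Type*} [NormedAddCommGroup E]
    [InnerProductSpace ℝ E] [CompleteSpace E] {f : E → ℝ} (hf : ContDiff ℝ 2 f) :
    Differentiable ℝ (gradient f) :=
  (AddMonoidHom.toRealLinearMap
    ((InnerProductSpace.toDual ℝ E).symm : StrongDual ℝ E →+ E)
    (InnerProductSpace.toDual ℝ E).symm.continuous).differentiable.comp
    ((hf.fderiv_right (m := 1) (by norm_num)).differentiable (by norm_num))

/-- Lyapunov monotonicity: along the zero-noise flow `x' = -v(x,λ)`, `λ' = μ h(x)` with
`v(x,λ) = ∇c x + (Dh x)* λ + μ (Dh x)* (h x)`, if the Fréchet derivative `A(t)` of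
`y ↦ v(y, λ(t))` at `x(t)` is positive semidefinite for all `t`, then the energy
`E = (1/2)‖v‖² + (μ/2)‖h‖²` is nonincreasing. -/
theorem stmt_10 (n m : ℕ) (c : EuclideanSpace ℝ (Fin n) → ℝ)
    (h : EuclideanSpace ℝ (Fin n) → EuclideanSpace ℝ (Fin m))
    (μ : ℝ) (hμ : 0 < μ) (hc : ContDiff ℝ 2 c) (hh : ContDiff ℝ 2 h)
    (v : EuclideanSpace ℝ (Fin n) → EuclideanSpace ℝ (Fin m) → EuclideanSpace ℝ (Fin n))
    (hv : ∀ y l, v y l =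
      gradient c y + (fderiv ℝ h y).adjoint l + μ • (fderiv ℝ h y).adjoint (h y))
    (x : ℝ → EuclideanSpace ℝ (Fin n)) (lam : ℝ → EuclideanSpace ℝ (Fin m))
    (hx : ∀ t, HasDerivAt x (-(v (x t) (lam t))) t)
    (hlam : ∀ t, HasDerivAt lam (μ • h (x t)) t)
    (hA : ∀ t, ∀ w : EuclideanSpace ℝ (Fin n),
      0 ≤ ⟪w, (fderiv ℝ (fun y => v y (lam t)) (x t)) w⟫)
    (E : ℝ → ℝ)
    (hE : ∀ t, E t = (1 / 2) * ‖v (x t) (lam t)‖ ^ 2 + (μ / 2) * ‖h (x t)‖ ^ 2) :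
    Antitone E := by
  have hDh : Differentiable ℝ (fderiv ℝ h) :=
    (hh.fderiv_right (m := 1) (by norm_num)).differentiable (by norm_num)
  have hhd : Differentiable ℝ h := hh.differentiable (by norm_num)
  have hadj : Differentiable ℝ (fun y => (fderiv ℝ h y).adjoint) :=
    ContinuousLinearMap.differentiable_adjoint.comp hDh
  have hvd : ∀ l, Differentiable ℝ (fun y => v y l) := fun l => by
    simp only [hv]
    exact (hc.differentiable_gradient.add (hadj.clm_apply (differentiable_const l))).add
      ((hadj.clm_apply hhd).const_smul μ)
  have hvt : ∀ t, HasDerivAt (fun s => v (x s) (lam s))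
      (fderiv ℝ (fun y => v y (lam t)) (x t) (-(v (x t) (lam t)))
        + (fderiv ℝ h (x t)).adjoint (μ • h (x t))) t := fun t => by
    have hfrozen := (hvd (lam t) (x t)).hasFDerivAt.comp_hasDerivAt t (hx t)
    have hrest := ((hadj (x t)).hasFDerivAt.comp_hasDerivAt t (hx t)).clm_apply
      ((hlam t).sub_const (lam t))
    refine ((hfrozen.add hrest).congr_deriv (by simp)).congr_of_eventuallyEq (.of_forall fun s => ?_)
    simp only [hv, Pi.add_apply, Function.comp_apply, map_sub]
    abel
  have hEt : ∀ t, HasDerivAt E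
      (-⟪v (x t) (lam t), fderiv ℝ (fun y => v y (lam t)) (x t) (v (x t) (lam t))⟫) t := fun t => by
    have hsum := ((hvt t).norm_sq.const_mul (1 / 2)).add
      ((((hhd (x t)).hasFDerivAt.comp_hasDerivAt t (hx t)).norm_sq).const_mul (μ / 2))
    refine (hsum.congr_deriv ?_).congr_of_eventuallyEq (.of_forall hE)
    simp only [Function.comp_apply, map_neg, map_smul, inner_add_right, inner_neg_right,
      inner_smul_right, ContinuousLinearMap.adjoint_inner_right]
    rw [real_inner_comm (h (x t))]
    ring
  refine antitone_of_deriv_nonpos (fun t => (hEt t).differentiableAt) fun t => ?_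
  rw [(hEt t).deriv]
  exact neg_nonpos.mpr (hA t _)
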